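/- Let (C, μ) be a flat-foldable MV pattern with C = (c_0, …, c_n), and let i with 1 ≤ i, i+1 ≤ n−1 be an index such that c_i − c_{i−1} > c_{i+1} − c_i and c_{i+2} − c_{i+1} > c_{i+1} − c_i (a crimpable pair with strictly longer neighboring intervals). Then μ(c_i) ≠ μ(c_{i+1}); i.e., no flat-foldable assignment gives both creases of such a pair the same mountain-valley value. -/

import Mathlib

/-- Mountain or valley label for a crease. -/
inductive MV : Type
  | M : MV
  | V : MV
deriving DecidableEq

/-- `(c 0, c 1, …, c n)` is a 1D crease pattern: a strictly increasing finite
sequence of reals with `n ≥ 1`.  The points `c 1, …, c (n-1)` are its creases,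
`c 0` and `c n` its ends. -/
def IsCreasePattern (n : ℕ) (c : ℕ → ℝ) : Prop :=
  1 ≤ n ∧ ∀ i j : ℕ, i < j → j ≤ n → c i < c j

/-- The consecutive creases `(c i, …, c (i+k))` form a crimpable sequence with gap `d`. -/
def IsCrimpable (n : ℕ) (c : ℕ → ℝ) (i k : ℕ) (d : ℝ) : Prop :=
  1 ≤ i ∧ 1 ≤ k ∧ i + k ≤ n - 1 ∧
  (∀ m : ℕ, i ≤ m → m < i + k → c (m + 1) - c m = d) ∧
  d < c i - c (i - 1) ∧ d < c (i + k + 1) - c (i + k)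

/-- Additive offset of the folded-position map on the `j`-th interval:
on `[c j, c (j+1)]` the folded-position map is `x ↦ (-1)^j * x + foldOffset c j`. -/
def foldOffset (c : ℕ → ℝ) : ℕ → ℝ
  | 0 => 0
  | j + 1 => foldOffset c (j) + 2 * (-1 : ℝ) ^ j * c (j + 1)

/-- Folded position of a point `x` belonging to the `j`-th interval `[c j, c (j+1)]`.
This is the unique continuous map equal to the identity on `[c 0, c 1]`, isometric on
every interval, and reversing direction at every crease. -/
def foldPos (c : ℕ → ℝ) (j : ℕ) (x : ℝ) : ℝ := (-1 : ℝ) ^ j * x + foldOffset c j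

/-- Folded position of the crease `c i`. -/
def foldCrease (c : ℕ → ℝ) (i : ℕ) : ℝ := foldPos c i (c i)

/-- `x` lies strictly `lt`-between `a` and `b`. -/
def Between (lt : ℕ → ℕ → Prop) (a b x : ℕ) : Prop :=
  (lt a x ∧ lt x b) ∨ (lt b x ∧ lt x a)

/-- The MV pattern `(C, μ)` is flat-foldable: there is a strict linear order `lt`
("strictly below") on the intervals `I_0, …, I_{n-1}` (indexed `0, …, n-1`) such that:
(i) for each crease `i`, `I_{i-1}` is below `I_i` iff either `μ i = V` and the folded map
is increasing on `I_{i-1}` (slope `(-1)^(i-1) = 1`), or `μ i = M` and it is decreasing;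
(ii) for each crease `i` and each interval `J` whose folded image contains the folded
crease position in its interior, `J` is not strictly between `I_{i-1}` and `I_i`;
(iii) for distinct creases `i, j` folding to the same point, it is not the case that
exactly one of `I_{j-1}`, `I_j` is strictly between `I_{i-1}` and `I_i`. -/
def IsFlatFoldable (n : ℕ) (c : ℕ → ℝ) (μ : ℕ → MV) : Prop :=
  ∃ lt : ℕ → ℕ → Prop,
    (∀ j, j < n → ¬ lt j j) ∧
    (∀ a b e, lt a b → lt b e → lt a e) ∧
    (∀ a b, a < n → b < n → a ≠ b → lt a b ∨ lt b a) ∧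
    (∀ a b, lt a b → a < n ∧ b < n) ∧
    (∀ i, 1 ≤ i → i ≤ n - 1 →
      (lt (i - 1) i ↔ ((μ i = MV.V ∧ Even (i - 1)) ∨ (μ i = MV.M ∧ Odd (i - 1))))) ∧
    (∀ i, 1 ≤ i → i ≤ n - 1 → ∀ j, j < n →
      foldCrease c i ∈
        Set.Ioo (min (foldPos c j (c j)) (foldPos c j (c (j + 1))))
                (max (foldPos c j (c j)) (foldPos c j (c (j + 1)))) →
      ¬ Between lt (i - 1) i j) ∧
    (∀ i j, 1 ≤ i → i ≤ n - 1 → 1 ≤ j → j ≤ n - 1 → i ≠ j →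
      foldCrease c i = foldCrease c j →
      (Between lt (i - 1) i (j - 1) ↔ Between lt (i - 1) i j))

/-- `F` is a forcing set for the MV pattern `(C, μ)`: a set of creases such that the only
flat-foldable assignment agreeing with `μ` on `F` is `μ` itself (on all creases). -/
def IsForcingSet (n : ℕ) (c : ℕ → ℝ) (μ : ℕ → MV) (F : Set ℕ) : Prop :=
  F ⊆ Set.Icc 1 (n - 1) ∧
  ∀ ν : ℕ → MV, IsFlatFoldable n c ν → (∀ x ∈ F, ν x = μ x) →
    ∀ x, 1 ≤ x → x ≤ n - 1 → ν x = μ x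

/-- The crease pattern produced by a monocrimp at the adjacent pair `(c j, c (j+1))`:
it deletes `c j` and `c (j+1)` and translates all later points by `-2 * (c (j+1) - c j)`. -/
def monocrimpPattern (c : ℕ → ℝ) (j : ℕ) : ℕ → ℝ :=
  fun x => if x < j then c x else c (x + 2) - 2 * (c (j + 1) - c j)

/-- In a crimpable pair, each of the two creases folds into the interior of the image of the
outer interval adjacent to the other crease. -/
theorem foldCrease_mem_Ioo_of_crimpable (c : ℕ → ℝ) (k : ℕ)
    (hm : c (k + 1) < c (k + 2))
    (hl : c (k + 2) - c (k + 1) < c (k + 1) - c k)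
    (hr : c (k + 2) - c (k + 1) < c (k + 3) - c (k + 2)) :
    foldCrease c (k + 1) ∈
        Set.Ioo (min (foldPos c (k + 2) (c (k + 2))) (foldPos c (k + 2) (c (k + 3))))
          (max (foldPos c (k + 2) (c (k + 2))) (foldPos c (k + 2) (c (k + 3)))) ∧
      foldCrease c (k + 2) ∈
        Set.Ioo (min (foldPos c k (c k)) (foldPos c k (c (k + 1))))
          (max (foldPos c k (c k)) (foldPos c k (c (k + 1)))) := by
  simp only [foldCrease, foldPos, foldOffset, Set.mem_Ioo, min_lt_iff, lt_max_iff, pow_succ]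
  rcases neg_one_pow_eq_or ℝ k with h | h <;> rw [h]
  · exact ⟨⟨Or.inl (by linarith), Or.inr (by linarith)⟩,
      ⟨Or.inl (by linarith), Or.inr (by linarith)⟩⟩
  · exact ⟨⟨Or.inr (by linarith), Or.inl (by linarith)⟩,
      ⟨Or.inr (by linarith), Or.inl (by linarith)⟩⟩

/-- If `(C, μ)` is flat-foldable and `(c i, c (i+1))` is a crimpable pair, i.e. both
neighboring intervals are strictly longer than the middle interval, then the two creases
cannot have the same mountain-valley value. -/
theorem crimpable_pair_opposite_parity (n : ℕ) (c : ℕ → ℝ) (μ : ℕ → MV)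
    (hC : IsCreasePattern n c) (hF : IsFlatFoldable n c μ)
    (i : ℕ) (hi1 : 1 ≤ i) (hi2 : i + 1 ≤ n - 1)
    (hl : c (i + 1) - c i < c i - c (i - 1))
    (hr : c (i + 1) - c i < c (i + 2) - c (i + 1)) :
    μ i ≠ μ (i + 1) := by
  intro hμ
  obtain ⟨lt, -, -, htotal, -, hdir, hcross, -⟩ := hF
  obtain ⟨k, rfl⟩ : ∃ k, i = k + 1 := ⟨i - 1, by omega⟩
  obtain ⟨hout, hin⟩ := foldCrease_mem_Ioo_of_crimpable c k
    (hC.2 (k + 1) (k + 2) (by omega) (by omega)) hl hr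
  have hnot_out := hcross (k + 1) (by omega) (by omega) (k + 2) (by omega) hout
  have hnot_in := hcross (k + 2) (by omega) (by omega) k (by omega) hin
  have hdir₁ := hdir (k + 1) (by omega) (by omega)
  have hdir₂ := hdir (k + 2) (by omega) (by omega)
  have h₀₁ := htotal k (k + 1) (by omega) (by omega) (by omega)
  have h₁₂ := htotal (k + 1) (k + 2) (by omega) (by omega) (by omega)
  have h₀₂ := htotal k (k + 2) (by omega) (by omega) (by omega)
  have hopp : lt k (k + 1) ↔ ¬ lt (k + 1) (k + 2) := by
    change lt k (k + 1) ↔ _ at hdir₁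
    change lt (k + 1) (k + 2) ↔ _ at hdir₂
    rw [hdir₁, hdir₂, ← hμ]
    cases μ (k + 1) <;> simp [Nat.even_add_one, Nat.odd_add_one]
  change ¬ Between lt k (k + 1) (k + 2) at hnot_out
  change ¬ Between lt (k + 1) (k + 2) k at hnot_in
  unfold Between at hnot_out hnot_in
  tauto
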